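/- arXiv:1903.04106 — 5 statements merged into one kernel-verified Lean document; each statement's English description precedes it below -/
import Mathlib

section
/- Let r, q ∈ ℝ, σ > 0, α ∈ ℝ, and let t < T and x > 0. Then (e^{−r(T−t)} / (σ√(2π(T−t)))) · ∫₀^∞ z^{α−1} · exp( −(ln(x/z) + (r − q − σ²/2)(T−t))² / (2σ²(T−t)) ) dz = e^{μ(α)(T−t)} · x^α. -/
open MeasureTheory

/-- `μ(α) = (α−1)r − αq + (σ²/2)(α²−α)` -/
noncomputable def mu (r q σ α : ℝ) : ℝ := (α - 1) * r - α * q + σ ^ 2 / 2 * (α ^ 2 - α)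

/-- The substitution `z = x * exp (y + k)` carries the integral over `(0, ∞)` to one over `ℝ`. -/
theorem integral_Ioi_eq_integral_mul_exp_add {x : ℝ} (hx : 0 < x) (k : ℝ) (f : ℝ → ℝ) :
    ∫ z in Set.Ioi (0 : ℝ), f z =
      ∫ y : ℝ, x * Real.exp (y + k) * f (x * Real.exp (y + k)) := by
  have himage : (fun y => x * Real.exp (y + k)) '' Set.univ = Set.Ioi 0 := by
    ext z
    simp only [Set.image_univ, Set.mem_range, Set.mem_Ioi]
    refine ⟨?_, fun hz => ⟨Real.log (z / x) - k, ?_⟩⟩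
    · rintro ⟨y, rfl⟩
      positivity
    · rw [sub_add_cancel, Real.exp_log (by positivity)]
      field_simp
  have hderiv : ∀ y ∈ Set.univ, HasDerivWithinAt (fun y => x * Real.exp (y + k))
      (x * Real.exp (y + k)) Set.univ y := fun y _ => by
    simpa using ((((hasDerivAt_id y).add_const k).exp).const_mul x)
  have hinj : Set.InjOn (fun y => x * Real.exp (y + k)) Set.univ := fun a _ b _ hab =>
    add_right_cancel (Real.exp_injective (mul_left_cancel₀ hx.ne' hab))
  rw [← himage, integral_image_eq_integral_abs_deriv_smul MeasurableSet.univ hderiv hinj,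
    setIntegral_univ]
  refine integral_congr_ae (.of_forall fun y => ?_)
  simp only [smul_eq_mul]
  rw [abs_of_pos (by positivity)]

/-- The `(α - 1)`-th moment of an unnormalised log-normal density. -/
theorem integral_rpow_mul_exp_neg_log_sq {x s : ℝ} (hx : 0 < x) (hs : 0 < s) (α c : ℝ) :
    ∫ z in Set.Ioi (0 : ℝ),
        z ^ (α - 1) * Real.exp (-(Real.log (x / z) + c) ^ 2 / (2 * s)) =
      x ^ α * Real.exp (α * c + α ^ 2 * s / 2) * Real.sqrt (2 * Real.pi * s) := by
  have hpt : ∀ y : ℝ, x * Real.exp (y + (c + α * s)) *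
      ((x * Real.exp (y + (c + α * s))) ^ (α - 1) *
        Real.exp (-(Real.log (x / (x * Real.exp (y + (c + α * s)))) + c) ^ 2 / (2 * s))) =
      x ^ α * Real.exp (α * c + α ^ 2 * s / 2) * Real.exp (-(1 / (2 * s)) * y ^ 2) := fun y => by
    have hlog : Real.log (x / (x * Real.exp (y + (c + α * s)))) = -(y + (c + α * s)) := by
      rw [div_mul_cancel_left₀ hx.ne', Real.log_inv, Real.log_exp]
    have hz : 0 < x * Real.exp (y + (c + α * s)) := by positivity
    rw [hlog, ← mul_assoc, mul_comm (x * _) (_ ^ _), ← Real.rpow_add_one hz.ne',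
      sub_add_cancel, Real.mul_rpow hx.le (Real.exp_pos _).le, ← Real.exp_mul,
      mul_assoc, mul_assoc, ← Real.exp_add, ← Real.exp_add]
    congr 2
    field_simp
    ring
  rw [integral_Ioi_eq_integral_mul_exp_add hx (c + α * s)]
  simp_rw [hpt]
  rw [integral_const_mul, integral_gaussian]
  congr 2
  field_simp

/-- **Theorem 1 (integral form).** The Black–Scholes propagator applied to the power payoff
`z ↦ z^α` equals `e^{μ(α)(T−t)} x^α`. -/
theorem power_standard_option_price (r q σ α t T x : ℝ)
    (hσ : 0 < σ) (htT : t < T) (hx : 0 < x) :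
    Real.exp (-(r * (T - t))) / (σ * Real.sqrt (2 * Real.pi * (T - t))) *
      ∫ z in Set.Ioi (0 : ℝ),
        z ^ (α - 1) *
          Real.exp (-(Real.log (x / z) + (r - q - σ ^ 2 / 2) * (T - t)) ^ 2 /
            (2 * σ ^ 2 * (T - t)))
      = Real.exp (mu r q σ α * (T - t)) * x ^ α := by
  have hτ : 0 < T - t := sub_pos.mpr htT
  have hsqrt : Real.sqrt (2 * Real.pi * (σ ^ 2 * (T - t))) =
      σ * Real.sqrt (2 * Real.pi * (T - t)) := by
    rw [show 2 * Real.pi * (σ ^ 2 * (T - t)) = σ ^ 2 * (2 * Real.pi * (T - t)) by ring,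
      Real.sqrt_mul (sq_nonneg σ), Real.sqrt_sq hσ.le]
  have hpos : 0 < σ * Real.sqrt (2 * Real.pi * (T - t)) := by positivity
  rw [mul_assoc 2 (σ ^ 2), integral_rpow_mul_exp_neg_log_sq hx (by positivity), hsqrt,
    div_mul_eq_mul_div, mul_div_assoc, mul_div_cancel_right₀ _ hpos.ne', mul_left_comm,
    ← Real.exp_add, mul_comm]
  congr 2
  unfold mu
  ring
end

section
/- Let r, q ∈ ℝ, σ > 0, α ∈ ℝ and T ∈ ℝ. Define V(x,t) = e^{μ(α)(T−t)} x^α for x > 0 and t ≤ T. Then for all x > 0 and t < T, ∂V/∂t(x,t) + (σ²/2)x² ∂²V/∂x²(x,t) + (r−q)x ∂V/∂x(x,t) − r·V(x,t) = 0, and V(x,T) = x^α. -/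
open MeasureTheory

/-- **Theorem 1 (PDE form).** `V(x,t) = e^{μ(α)(T−t)} x^α` solves the Black–Scholes
terminal-value problem with terminal payoff `x^α`. -/
theorem power_standard_option_solves_BS (r q σ α T : ℝ) (hσ : 0 < σ)
    (V : ℝ → ℝ → ℝ)
    (hV : ∀ x t : ℝ, 0 < x → t ≤ T → V x t = Real.exp (mu r q σ α * (T - t)) * x ^ α) :
    (∀ x t : ℝ, 0 < x → t < T →
      deriv (fun u => V x u) t
        + σ ^ 2 / 2 * x ^ 2 * deriv (fun y => deriv (fun z => V z t) y) x
        + (r - q) * x * deriv (fun y => V y t) x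
        - r * V x t = 0) ∧
    (∀ x : ℝ, 0 < x → V x T = x ^ α) := by
  have hderiv : ∀ y t : ℝ, 0 < y → t < T →
      deriv (fun z => V z t) y = Real.exp (mu r q σ α * (T - t)) * (α * y ^ (α - 1)) := by
    intro y t hy ht
    have hloc : (fun z => V z t) =ᶠ[nhds y]
        fun z => Real.exp (mu r q σ α * (T - t)) * z ^ α := by
      filter_upwards [lt_mem_nhds hy] with z hz using hV z t hz ht.le
    rw [hloc.deriv_eq]
    exact ((Real.hasDerivAt_rpow_const (Or.inl hy.ne')).const_mul _).deriv
  refine ⟨fun x t hx ht => ?_, fun x hx => by simp [hV x T hx le_rfl]⟩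
  have htime : deriv (fun u => V x u) t
      = Real.exp (mu r q σ α * (T - t)) * (mu r q σ α * (-1)) * x ^ α := by
    have hloc : (fun u => V x u) =ᶠ[nhds t]
        fun u => Real.exp (mu r q σ α * (T - u)) * x ^ α := by
      filter_upwards [gt_mem_nhds ht] with u hu using hV x u hx hu.le
    rw [hloc.deriv_eq]
    exact ((((hasDerivAt_id t).const_sub T).const_mul _).exp.mul_const _).deriv
  have hsecond : deriv (fun y => deriv (fun z => V z t) y) x
      = Real.exp (mu r q σ α * (T - t)) * (α * ((α - 1) * x ^ (α - 1 - 1))) := by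
    have hloc : (fun y => deriv (fun z => V z t) y) =ᶠ[nhds x]
        fun y => Real.exp (mu r q σ α * (T - t)) * (α * y ^ (α - 1)) := by
      filter_upwards [lt_mem_nhds hx] with y hy using hderiv y t hy ht
    rw [hloc.deriv_eq]
    exact (((Real.hasDerivAt_rpow_const (Or.inl hx.ne')).const_mul _).const_mul _).deriv
  rw [htime, hsecond, hderiv x t hx ht, hV x t hx ht.le,
    Real.rpow_sub_one hx.ne', Real.rpow_sub_one hx.ne']
  have hx' := hx.ne'
  generalize Real.exp (mu r q σ α * (T - t)) = E
  unfold mu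
  field_simp
  ring
end

section
/- Let r, q ∈ ℝ, σ > 0, α ∈ ℝ, ξ > 0, s ∈ {1, −1}, t < T and x > 0. Then (e^{−r(T−t)} / (σ√(2π(T−t)))) · ∫_{{z > 0 : s·z > s·ξ}} z^{α−1} · exp( −(ln(x/z) + (r − q − σ²/2)(T−t))² / (2σ²(T−t)) ) dz = e^{μ(α)(T−t)} · x^α · N(s·d), where d = [ln(x/ξ) + (r − q − σ²/2 + ασ²)(T−t)] / (σ√(T−t)). -/
open MeasureTheory

/-- The standard normal cumulative distribution function. -/
noncomputable def normCDF (d : ℝ) : ℝ :=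
  (Real.sqrt (2 * Real.pi))⁻¹ * ∫ y in Set.Iio d, Real.exp (-y ^ 2 / 2)

/-- Change of variables `z = exp (c - s * a * y)` on a half-line. -/
theorem integral_half_line_eq_integral_exp_affine {s : ℝ} (hs : s = 1 ∨ s = -1) {a : ℝ}
    (ha : 0 < a) (c : ℝ) {ξ : ℝ} (hξ : 0 < ξ) (g : ℝ → ℝ) :
    ∫ z in {z : ℝ | 0 < z ∧ s * z > s * ξ}, g z =
      ∫ y in Set.Iio (s * ((c - Real.log ξ) / a)),
        a * Real.exp (c - s * a * y) * g (Real.exp (c - s * a * y)) := by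
  have hs2 : s * s = 1 := by rcases hs with rfl | rfl <;> norm_num
  have habs : |s| = 1 := by rcases hs with rfl | rfl <;> norm_num
  have hs0 : s ≠ 0 := by rintro rfl; norm_num at hs2
  have hmem : ∀ y, s * Real.exp (c - s * a * y) > s * ξ ↔ y < s * ((c - Real.log ξ) / a) := by
    intro y
    rw [← mul_div_assoc, lt_div_iff₀ ha]
    rcases hs with rfl | rfl
    · simp only [one_mul, gt_iff_lt]
      rw [← Real.log_lt_iff_lt_exp hξ]
      constructor <;> intro h <;> linarith
    · rw [gt_iff_lt, neg_one_mul ξ, neg_one_mul (Real.exp _), neg_lt_neg_iff, ← Real.lt_log_iff_exp_lt hξ]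
      constructor <;> intro h <;> linarith
  have himage : {z : ℝ | 0 < z ∧ s * z > s * ξ} =
      (fun y => Real.exp (c - s * a * y)) '' Set.Iio (s * ((c - Real.log ξ) / a)) := by
    ext z
    constructor
    · rintro ⟨hz, hzξ⟩
      have hexp : Real.exp (c - s * a * (s * ((c - Real.log z) / a))) = z := by
        have : c - s * a * (s * ((c - Real.log z) / a)) = Real.log z := by
          field_simp
          linear_combination (Real.log z - c) * hs2
        rw [this, Real.exp_log hz]
      exact ⟨_, (hmem _).1 (by rwa [hexp]), hexp⟩
    · rintro ⟨y, hy, rfl⟩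
      exact ⟨Real.exp_pos _, (hmem y).2 hy⟩
  have hderiv : ∀ y ∈ Set.Iio (s * ((c - Real.log ξ) / a)),
      HasDerivWithinAt (fun y => Real.exp (c - s * a * y))
        (Real.exp (c - s * a * y) * -(s * a)) (Set.Iio (s * ((c - Real.log ξ) / a))) y := by
    intro y _
    have h := (((hasDerivAt_id y).const_mul (s * a)).const_sub c).exp
    simpa using h.hasDerivWithinAt
  have hinj : Set.InjOn (fun y => Real.exp (c - s * a * y))
      (Set.Iio (s * ((c - Real.log ξ) / a))) := by
    intro y _ y' _ h
    have h' := Real.exp_injective h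
    exact mul_left_cancel₀ (mul_ne_zero hs0 ha.ne') (sub_right_injective h')
  rw [himage, integral_image_eq_integral_abs_deriv_smul measurableSet_Iio hderiv hinj]
  refine integral_congr_ae (Filter.Eventually.of_forall fun y => ?_)
  simp only [smul_eq_mul, abs_mul, abs_neg, habs, abs_of_pos ha, Real.abs_exp]
  ring

/-- **Theorem 2 (integral form).** The pricing formula for the α-power binary option with
strike `ξ` and sign indicator `s`. -/
theorem power_binary_option_price (r q σ α ξ s t T x : ℝ)
    (hσ : 0 < σ) (hξ : 0 < ξ) (hs : s = 1 ∨ s = -1) (htT : t < T) (hx : 0 < x) :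
    Real.exp (-(r * (T - t))) / (σ * Real.sqrt (2 * Real.pi * (T - t))) *
      ∫ z in {z : ℝ | 0 < z ∧ s * z > s * ξ},
        z ^ (α - 1) *
          Real.exp (-(Real.log (x / z) + (r - q - σ ^ 2 / 2) * (T - t)) ^ 2 /
            (2 * σ ^ 2 * (T - t)))
      = Real.exp (mu r q σ α * (T - t)) * x ^ α *
          normCDF (s * ((Real.log (x / ξ) + (r - q - σ ^ 2 / 2 + α * σ ^ 2) * (T - t)) /
            (σ * Real.sqrt (T - t)))) := by
  have hs2 : s ^ 2 = 1 := by rcases hs with rfl | rfl <;> norm_num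
  obtain ⟨τ, hτ⟩ : ∃ τ, τ = T - t := ⟨_, rfl⟩
  have hτ0 : 0 < τ := by linarith
  rw [← hτ]
  have hw : 0 < Real.sqrt τ := Real.sqrt_pos.2 hτ0
  have hwsq : Real.sqrt τ ^ 2 = τ := Real.sq_sqrt hτ0.le
  have hdrift : Real.log (x / ξ) + (r - q - σ ^ 2 / 2 + α * σ ^ 2) * τ =
      Real.log x + (r - q - σ ^ 2 / 2 + α * σ ^ 2) * τ - Real.log ξ := by
    rw [Real.log_div hx.ne' hξ.ne']
    ring
  have hintegrand : ∀ y : ℝ,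
      σ * Real.sqrt τ * Real.exp (Real.log x + (r - q - σ ^ 2 / 2 + α * σ ^ 2) * τ -
          s * (σ * Real.sqrt τ) * y) *
        (Real.exp (Real.log x + (r - q - σ ^ 2 / 2 + α * σ ^ 2) * τ -
            s * (σ * Real.sqrt τ) * y) ^ (α - 1) *
          Real.exp (-(Real.log (x / Real.exp (Real.log x +
              (r - q - σ ^ 2 / 2 + α * σ ^ 2) * τ - s * (σ * Real.sqrt τ) * y)) +
                (r - q - σ ^ 2 / 2) * τ) ^ 2 / (2 * σ ^ 2 * τ))) =
      σ * Real.sqrt τ * Real.exp (r * τ) * Real.exp (mu r q σ α * τ) * x ^ α *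
        Real.exp (-y ^ 2 / 2) := by
    intro y
    rw [Real.log_div hx.ne' (Real.exp_ne_zero _), Real.log_exp, ← Real.exp_mul,
      Real.rpow_def_of_pos hx]
    simp only [mul_assoc (σ * Real.sqrt τ), ← Real.exp_add]
    congr 2
    have hquad : -(Real.log x - (Real.log x + (r - q - σ ^ 2 / 2 + α * σ ^ 2) * τ -
          s * (σ * Real.sqrt τ) * y) + (r - q - σ ^ 2 / 2) * τ) ^ 2 / (2 * σ ^ 2 * τ) =
        -(y ^ 2 - 2 * s * α * (σ * Real.sqrt τ) * y + α ^ 2 * σ ^ 2 * τ) / 2 := by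
      rw [div_eq_div_iff (by positivity) two_ne_zero]
      linear_combination (-2 * σ ^ 2 * y ^ 2 * Real.sqrt τ ^ 2) * hs2 - 2 * σ ^ 2 * y ^ 2 * hwsq
    rw [hquad, mu]
    ring
  rw [hdrift, integral_half_line_eq_integral_exp_affine hs (mul_pos hσ hw)
    (Real.log x + (r - q - σ ^ 2 / 2 + α * σ ^ 2) * τ) hξ]
  simp only [hintegrand]
  rw [integral_const_mul, normCDF, Real.sqrt_mul (by positivity), Real.exp_neg]
  have hπ : 0 < Real.sqrt (2 * Real.pi) := Real.sqrt_pos.2 (by positivity)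
  field_simp
end

section
/- Let r, q ∈ ℝ, σ > 0, α ∈ ℝ, ξ > 0, s ∈ {1, −1} and T ∈ ℝ. Define V(x,t) = e^{μ(α)(T−t)} x^α N(s·d(x,t)) for x > 0, t < T, where d(x,t) = [ln(x/ξ) + (r − q − σ²/2 + ασ²)(T−t)] / (σ√(T−t)). Then (a) for all x > 0 and t < T, ∂V/∂t + (σ²/2)x² ∂²V/∂x² + (r−q)x ∂V/∂x − rV = 0; and (b) for every x > 0 with x ≠ ξ, lim_{t → T⁻} V(x,t) = x^α if s·(x − ξ) > 0 and lim_{t → T⁻} V(x,t) = 0 if s·(x − ξ) < 0. -/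
open MeasureTheory Filter Topology

/-- The standard normal density. -/
noncomputable def normPDF (y : ℝ) : ℝ := (Real.sqrt (2 * Real.pi))⁻¹ * Real.exp (-y ^ 2 / 2)

lemma integrable_exp_neg_sq_div_two : Integrable (fun y : ℝ => Real.exp (-y ^ 2 / 2)) := by
  refine (integrable_exp_neg_mul_sq (b := 1 / 2) (by norm_num)).congr (.of_forall fun y => ?_)
  simp only
  congr 1
  ring

lemma integral_exp_neg_sq_div_two : ∫ y : ℝ, Real.exp (-y ^ 2 / 2) = Real.sqrt (2 * Real.pi) := by
  have h := integral_gaussian (1 / 2)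
  rw [show Real.pi / (1 / 2) = 2 * Real.pi by ring] at h
  rw [← h]
  refine integral_congr_ae (.of_forall fun y => ?_)
  simp only
  congr 1
  ring

lemma hasDerivAt_normCDF (d : ℝ) : HasDerivAt normCDF (normPDF d) d := by
  have hc : Continuous fun y : ℝ => Real.exp (-y ^ 2 / 2) := by fun_prop
  have h := ((hc.integral_hasStrictDerivAt 0 d).hasDerivAt.const_add
    (∫ y in Set.Iic 0, Real.exp (-y ^ 2 / 2))).const_mul (Real.sqrt (2 * Real.pi))⁻¹
  refine h.congr_of_eventuallyEq (.of_forall fun u => ?_)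
  have hi := intervalIntegral.integral_Iic_sub_Iic (a := 0) (b := u)
    integrable_exp_neg_sq_div_two.integrableOn integrable_exp_neg_sq_div_two.integrableOn
  simp only [normCDF, ← integral_Iic_eq_integral_Iio, ← hi]
  ring

lemma hasDerivAt_normPDF (d : ℝ) : HasDerivAt normPDF (-d * normPDF d) d := by
  have h := ((((hasDerivAt_id d).pow 2).neg.div_const 2).exp).const_mul
    (Real.sqrt (2 * Real.pi))⁻¹
  refine h.congr_deriv ?_
  simp [normPDF]
  ring

lemma tendsto_normCDF_atTop : Tendsto normCDF atTop (𝓝 1) := by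
  have h := ((aecover_Iio (μ := volume) (tendsto_id (α := ℝ)
    (x := atTop))).integral_tendsto_of_countably_generated integrable_exp_neg_sq_div_two).const_mul (Real.sqrt (2 * Real.pi))⁻¹
  rw [integral_exp_neg_sq_div_two, inv_mul_cancel₀ (by positivity)] at h
  exact h

lemma tendsto_normCDF_atBot : Tendsto normCDF atBot (𝓝 0) := by
  have h := (((aecover_Ici (μ := volume) (tendsto_id (α := ℝ)
    (x := atBot))).integral_tendsto_of_countably_generated integrable_exp_neg_sq_div_two).const_sub (Real.sqrt (2 * Real.pi))).const_mul
      (Real.sqrt (2 * Real.pi))⁻¹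
  rw [integral_exp_neg_sq_div_two, sub_self, mul_zero] at h
  refine h.congr fun d => ?_
  have hs := integral_add_compl (measurableSet_Iio (a := d)) integrable_exp_neg_sq_div_two
  rw [integral_exp_neg_sq_div_two, Set.compl_Iio] at hs
  simp only [normCDF, id, ← hs]
  ring

/-- The closed form of the power binary option price. -/
noncomputable def powerBinaryPrice (m c σ α ξ s τ x : ℝ) : ℝ :=
  Real.exp (m * τ) * x ^ α * normCDF (s * ((Real.log (x / ξ) + c * τ) / (σ * Real.sqrt τ)))

/-- The closed form of the derivative of `powerBinaryPrice` in the spot price. -/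
noncomputable def powerBinaryDelta (m c σ α ξ s τ x : ℝ) : ℝ :=
  Real.exp (m * τ) * (x ^ α / x) *
    (α * normCDF (s * ((Real.log (x / ξ) + c * τ) / (σ * Real.sqrt τ))) +
      s / (σ * Real.sqrt τ) * normPDF (s * ((Real.log (x / ξ) + c * τ) / (σ * Real.sqrt τ))))

section derivatives

variable {m c σ α ξ s τ x : ℝ}

lemma hasDerivAt_moneyness_spot (hξ : 0 < ξ) (hx : 0 < x) :
    HasDerivAt (fun y => s * ((Real.log (y / ξ) + c * τ) / (σ * Real.sqrt τ)))
      (s / (σ * Real.sqrt τ) / x) x := by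
  have h := (((((hasDerivAt_id x).div_const ξ).log (div_pos hx hξ).ne').add_const
    (c * τ)).div_const (σ * Real.sqrt τ)).const_mul s
  refine h.congr_deriv ?_
  simp only [id]
  rw [show 1 / ξ / (x / ξ) = 1 / x by field_simp]
  ring

lemma hasDerivAt_moneyness_time (hσ : 0 < σ) (hτ : 0 < τ) :
    HasDerivAt (fun v => s * ((Real.log (x / ξ) + c * v) / (σ * Real.sqrt v)))
      (s * (c / (σ * Real.sqrt τ) - (Real.log (x / ξ) + c * τ) / (σ * Real.sqrt τ) / (2 * τ))) τ := by
  have hw : 0 < Real.sqrt τ := Real.sqrt_pos.2 hτ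
  have h := ((((hasDerivAt_id τ).const_mul c).const_add (Real.log (x / ξ))).div
    ((Real.hasDerivAt_sqrt hτ.ne').const_mul σ) (by positivity)).const_mul s
  refine h.congr_deriv ?_
  simp only [id]
  have h2 : τ = Real.sqrt τ ^ 2 := (Real.sq_sqrt hτ.le).symm
  generalize Real.sqrt τ = w at *
  subst h2
  field_simp

lemma hasDerivAt_rpow_div (hx : 0 < x) :
    HasDerivAt (fun y : ℝ => y ^ α) (α * (x ^ α / x)) x := by
  rw [← Real.rpow_sub_one hx.ne']
  exact Real.hasDerivAt_rpow_const (.inl hx.ne')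

lemma hasDerivAt_powerBinaryPrice_spot (hξ : 0 < ξ) (hx : 0 < x) :
    HasDerivAt (powerBinaryPrice m c σ α ξ s τ) (powerBinaryDelta m c σ α ξ s τ x) x := by
  have h := ((hasDerivAt_rpow_div (α := α) hx).const_mul (Real.exp (m * τ))).mul
    ((hasDerivAt_normCDF _).comp x
      (hasDerivAt_moneyness_spot (c := c) (σ := σ) (s := s) (τ := τ) hξ hx))
  refine h.congr_deriv ?_
  simp only [powerBinaryDelta, Function.comp]
  ring

lemma hasDerivAt_powerBinaryDelta (hξ : 0 < ξ) (hx : 0 < x) :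
    HasDerivAt (powerBinaryDelta m c σ α ξ s τ)
      ((α - 1) / x * powerBinaryDelta m c σ α ξ s τ x +
        Real.exp (m * τ) * (x ^ α / x) * (s / (σ * Real.sqrt τ) / x) *
          (α - s / (σ * Real.sqrt τ) *
            (s * ((Real.log (x / ξ) + c * τ) / (σ * Real.sqrt τ)))) *
          normPDF (s * ((Real.log (x / ξ) + c * τ) / (σ * Real.sqrt τ)))) x := by
  have hd := hasDerivAt_moneyness_spot (c := c) (σ := σ) (s := s) (τ := τ) hξ hx
  have h := ((((hasDerivAt_rpow_div (α := α) hx).div (hasDerivAt_id x) hx.ne').const_mul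
      (Real.exp (m * τ))).mul
    ((((hasDerivAt_normCDF _).comp x hd).const_mul α).add
      (((hasDerivAt_normPDF _).comp x hd).const_mul (s / (σ * Real.sqrt τ)))))
  refine h.congr_deriv ?_
  simp only [powerBinaryDelta, Function.comp, id, Pi.add_apply, Pi.div_apply]
  have hx' := hx.ne'
  generalize s / (σ * Real.sqrt τ) = k
  field_simp
  ring

lemma hasDerivAt_powerBinaryPrice_time (hσ : 0 < σ) (hτ : 0 < τ) :
    HasDerivAt (fun v => powerBinaryPrice m c σ α ξ s v x)
      (m * powerBinaryPrice m c σ α ξ s τ x + Real.exp (m * τ) * x ^ α *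
        (s * (c / (σ * Real.sqrt τ) -
          (Real.log (x / ξ) + c * τ) / (σ * Real.sqrt τ) / (2 * τ))) *
        normPDF (s * ((Real.log (x / ξ) + c * τ) / (σ * Real.sqrt τ)))) τ := by
  have h := ((((hasDerivAt_id τ).const_mul m).exp).mul_const (x ^ α)).mul
    ((hasDerivAt_normCDF _).comp τ
      (hasDerivAt_moneyness_time (c := c) (s := s) (x := x) (ξ := ξ) hσ hτ))
  refine h.congr_deriv ?_
  simp only [powerBinaryPrice, Function.comp, id]
  ring

end derivatives

lemma powerBinaryPrice_blackScholes {r q σ α ξ s τ x c m d : ℝ} (hσ : 0 < σ)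
    (hs : s ^ 2 = 1) (hτ : 0 < τ) (hx : 0 < x)
    (hc : c = r - q - σ ^ 2 / 2 + α * σ ^ 2) (hm : m = mu r q σ α)
    (hd : d = (Real.log (x / ξ) + c * τ) / (σ * Real.sqrt τ)) :
    -(m * powerBinaryPrice m c σ α ξ s τ x + Real.exp (m * τ) * x ^ α *
        (s * (c / (σ * Real.sqrt τ) - d / (2 * τ))) * normPDF (s * d))
      + σ ^ 2 / 2 * x ^ 2 * ((α - 1) / x * powerBinaryDelta m c σ α ξ s τ x +
        Real.exp (m * τ) * (x ^ α / x) * (s / (σ * Real.sqrt τ) / x) *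
          (α - s / (σ * Real.sqrt τ) * (s * d)) * normPDF (s * d))
      + (r - q) * x * powerBinaryDelta m c σ α ξ s τ x
      - r * powerBinaryPrice m c σ α ξ s τ x = 0 := by
  simp only [powerBinaryPrice, powerBinaryDelta, ← hd]
  rw [mu] at hm
  have hw : 0 < Real.sqrt τ := Real.sqrt_pos.2 hτ
  have h2 : τ = Real.sqrt τ ^ 2 := (Real.sq_sqrt hτ.le).symm
  clear hd
  generalize Real.exp (m * τ) = E
  generalize normCDF (s * d) = N
  generalize normPDF (s * d) = P
  generalize x ^ α = X
  generalize Real.sqrt τ = w at *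
  subst h2 hm hc
  field_simp
  linear_combination (-(E * X * σ * s * d * P)) * hs

lemma tendsto_div_mul_sqrt_atTop {σ : ℝ} (hσ : 0 < σ) (c T : ℝ) {L : ℝ} (hL : 0 < L) :
    Tendsto (fun t => (L + c * (T - t)) / (σ * Real.sqrt (T - t))) (𝓝[<] T) atTop := by
  have h1 : Tendsto (fun t => L + c * (T - t)) (𝓝[<] T) (𝓝 L) := by
    have : Continuous fun t => L + c * (T - t) := by fun_prop
    simpa using (this.tendsto T).mono_left nhdsWithin_le_nhds
  have h2 : Tendsto (fun t => σ * Real.sqrt (T - t)) (𝓝[<] T) (𝓝[>] 0) := by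
    refine tendsto_nhdsWithin_iff.2 ⟨?_, ?_⟩
    · have : Continuous fun t => σ * Real.sqrt (T - t) := by fun_prop
      simpa using (this.tendsto T).mono_left nhdsWithin_le_nhds
    · filter_upwards [self_mem_nhdsWithin] with t ht
      exact mul_pos hσ (Real.sqrt_pos.2 (sub_pos.2 ht))
  exact (h1.pos_mul_atTop hL h2.inv_tendsto_nhdsGT_zero).congr fun t => (div_eq_mul_inv _ _).symm

lemma tendsto_div_mul_sqrt_atBot {σ : ℝ} (hσ : 0 < σ) (c T : ℝ) {L : ℝ} (hL : L < 0) :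
    Tendsto (fun t => (L + c * (T - t)) / (σ * Real.sqrt (T - t))) (𝓝[<] T) atBot := by
  refine (tendsto_neg_atTop_atBot.comp
    (tendsto_div_mul_sqrt_atTop hσ (-c) T (neg_pos.2 hL))).congr fun t => ?_
  simp only [Function.comp]
  ring

lemma mul_log_div_pos {s x ξ : ℝ} (hs : s = 1 ∨ s = -1) (hx : 0 < x) (hξ : 0 < ξ)
    (h : 0 < s * (x - ξ)) : 0 < s * Real.log (x / ξ) := by
  rw [Real.log_div hx.ne' hξ.ne']
  rcases hs with rfl | rfl
  · have := Real.log_lt_log hξ (by linarith : ξ < x)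
    linarith
  · have := Real.log_lt_log hx (by linarith : x < ξ)
    linarith

lemma mul_log_div_neg {s x ξ : ℝ} (hs : s = 1 ∨ s = -1) (hx : 0 < x) (hξ : 0 < ξ)
    (h : s * (x - ξ) < 0) : s * Real.log (x / ξ) < 0 := by
  have := mul_log_div_pos (s := -s) (by rcases hs with rfl | rfl <;> simp) hx hξ (by linarith)
  linarith

/-- **Theorem 2 (PDE form).** The α-power binary option price
`V(x,t) = e^{μ(α)(T−t)} x^α N(s·d(x,t))` solves the Black–Scholes equation for `t < T`
and attains the discontinuous terminal payoff `x^α · 1(s·x > s·ξ)` as `t → T⁻`. -/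
theorem power_binary_option_solves_BS (r q σ α ξ s T : ℝ)
    (hσ : 0 < σ) (hξ : 0 < ξ) (hs : s = 1 ∨ s = -1)
    (V : ℝ → ℝ → ℝ)
    (hV : ∀ x t : ℝ, 0 < x → t < T →
      V x t = Real.exp (mu r q σ α * (T - t)) * x ^ α *
        normCDF (s * ((Real.log (x / ξ) + (r - q - σ ^ 2 / 2 + α * σ ^ 2) * (T - t)) /
          (σ * Real.sqrt (T - t))))) :
    (∀ x t : ℝ, 0 < x → t < T →
      deriv (fun u => V x u) t
        + σ ^ 2 / 2 * x ^ 2 * deriv (fun y => deriv (fun z => V z t) y) x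
        + (r - q) * x * deriv (fun y => V y t) x
        - r * V x t = 0) ∧
    (∀ x : ℝ, 0 < x → x ≠ ξ →
      (s * (x - ξ) > 0 →
        Tendsto (fun t => V x t) (𝓝[<] T) (𝓝 (x ^ α))) ∧
      (s * (x - ξ) < 0 →
        Tendsto (fun t => V x t) (𝓝[<] T) (𝓝 0))) := by
  set c := r - q - σ ^ 2 / 2 + α * σ ^ 2 with hc
  set m := mu r q σ α with hm
  have hV' : ∀ x t : ℝ, 0 < x → t < T → V x t = powerBinaryPrice m c σ α ξ s (T - t) x := hV
  have hs2 : s ^ 2 = 1 := by rcases hs with rfl | rfl <;> norm_num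
  refine ⟨fun x t hx ht => ?_, fun x hx _ => ?_⟩
  · have hτ : 0 < T - t := sub_pos.2 ht
    have hx1 : ∀ y, 0 < y →
        deriv (fun z => V z t) y = powerBinaryDelta m c σ α ξ s (T - t) y := fun y hy =>
      ((hasDerivAt_powerBinaryPrice_spot hξ hy).congr_of_eventuallyEq <| by
        filter_upwards [lt_mem_nhds hy] with z hz using hV' z t hz ht).deriv
    have hx2 := ((hasDerivAt_powerBinaryDelta (m := m) (c := c) (σ := σ) (α := α) (s := s)
      (τ := T - t) hξ hx).congr_of_eventuallyEq
        (f₁ := fun y => deriv (fun z => V z t) y) <| by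
          filter_upwards [lt_mem_nhds hx] with y hy using hx1 y hy).deriv
    have ht1 := (((hasDerivAt_powerBinaryPrice_time (m := m) (c := c) (α := α) (ξ := ξ) (s := s)
      (x := x) hσ hτ).comp t ((hasDerivAt_id t).const_sub T)).congr_of_eventuallyEq
        (f₁ := fun u => V x u) <| by
          filter_upwards [gt_mem_nhds ht] with u hu using hV' x u hx hu).deriv
    rw [ht1, hx2, hx1 x hx, hV' x t hx ht, mul_neg_one]
    exact powerBinaryPrice_blackScholes hσ hs2 hτ hx hc hm rfl
  · have hfactor : Tendsto (fun t => Real.exp (m * (T - t)) * x ^ α) (𝓝[<] T) (𝓝 (x ^ α)) := by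
      have : Continuous fun t => Real.exp (m * (T - t)) * x ^ α := by fun_prop
      simpa using (this.tendsto T).mono_left nhdsWithin_le_nhds
    have hrw : ∀ t < T, Real.exp (m * (T - t)) * x ^ α * normCDF
        ((s * Real.log (x / ξ) + s * c * (T - t)) / (σ * Real.sqrt (T - t))) = V x t := by
      intro t ht
      rw [hV x t hx ht]
      congr 2
      ring
    refine ⟨fun h => ?_, fun h => ?_⟩
    · have hN := hfactor.mul (tendsto_normCDF_atTop.comp
        (tendsto_div_mul_sqrt_atTop hσ (s * c) T (mul_log_div_pos hs hx hξ h)))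
      rw [mul_one] at hN
      exact hN.congr' (by filter_upwards [self_mem_nhdsWithin] with t ht using hrw t ht)
    · have hN := hfactor.mul (tendsto_normCDF_atBot.comp
        (tendsto_div_mul_sqrt_atBot hσ (s * c) T (mul_log_div_neg hs hx hξ h)))
      rw [mul_zero] at hN
      exact hN.congr' (by filter_upwards [self_mem_nhdsWithin] with t ht using hrw t ht)
end

section
/- Let r, q ∈ ℝ, σ > 0, α ∈ ℝ, ξ₀, ξ₁ > 0, s₀, s₁ ∈ {1, −1}, t < T₀ < T₁, and x > 0. Then (e^{−r(T₀−t)} / (σ√(2π(T₀−t)))) · ∫_{{z > 0 : s₀z > s₀ξ₀}} z^{−1} · exp( −(ln(x/z) + (r − q − σ²/2)(T₀−t))² / (2σ²(T₀−t)) ) · e^{μ(α)(T₁−T₀)} z^α N( s₁·[ln(z/ξ₁) + (r − q − σ²/2 + ασ²)(T₁−T₀)] / (σ√(T₁−T₀)) ) dz = x^α e^{μ(α)(T₁−t)} N₂( s₀d₀, s₁d₁; s₀s₁ρ ), where d_i = [ln(x/ξ_i) + (r − q − σ²/2 + ασ²)(T_i−t)] / (σ√(T_i−t)) for i = 0,1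 and ρ = √((T₀−t)/(T₁−t)). -/
open MeasureTheory

/-- The bivariate standard normal cumulative distribution function with correlation `ρ`. -/
noncomputable def normCDF2 (a b ρ : ℝ) : ℝ :=
  (1 / (2 * Real.pi * Real.sqrt (1 - ρ ^ 2))) *
    ∫ y₀ in Set.Iio a, ∫ y₁ in Set.Iio b,
      Real.exp (-(y₀ ^ 2 - 2 * ρ * y₀ * y₁ + y₁ ^ 2) / (2 * (1 - ρ ^ 2)))

/-- Affine substitution `y = s * u + c` on a lower half-line. -/
lemma setIntegral_Iio_comp_sub_div (g : ℝ → ℝ) {s : ℝ} (hs : 0 < s) (b c : ℝ) :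
    ∫ y in Set.Iio b, g ((y - c) / s) = s * ∫ u in Set.Iio ((b - c) / s), g u := by
  have himage : (fun u : ℝ => s * u + c) '' Set.Iio ((b - c) / s) = Set.Iio b := by
    ext y
    simp only [Set.mem_image, Set.mem_Iio]
    constructor
    · rintro ⟨u, hu, rfl⟩
      rw [lt_div_iff₀ hs] at hu
      linarith
    · intro hy
      exact ⟨(y - c) / s, by gcongr, by field_simp; ring⟩
  have hderiv : ∀ u ∈ Set.Iio ((b - c) / s),
      HasDerivWithinAt (fun u : ℝ => s * u + c) s (Set.Iio ((b - c) / s)) u := fun u _ => by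
    simpa using (((hasDerivAt_id u).const_mul s).add_const c).hasDerivWithinAt
  have hinj : Set.InjOn (fun u : ℝ => s * u + c) (Set.Iio ((b - c) / s)) := fun u _ v _ h => by
    simpa [hs.ne'] using h
  rw [← himage, integral_image_eq_integral_abs_deriv_smul measurableSet_Iio hderiv hinj,
    ← integral_const_mul]
  refine setIntegral_congr_fun measurableSet_Iio fun u _ => ?_
  simp [abs_of_pos hs, hs.ne']

/-- The bivariate normal CDF as a Gaussian average of the univariate one, obtained by
conditioning on the first variable. -/
lemma normCDF2_eq_integral_normCDF (a b : ℝ) {ρ : ℝ} (hρ : 0 < 1 - ρ ^ 2) :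
    normCDF2 a b ρ = (Real.sqrt (2 * Real.pi))⁻¹ *
      ∫ y in Set.Iio a, Real.exp (-y ^ 2 / 2) * normCDF ((b - ρ * y) / Real.sqrt (1 - ρ ^ 2)) := by
  have hs : 0 < Real.sqrt (1 - ρ ^ 2) := Real.sqrt_pos.2 hρ
  have hsq : Real.sqrt (1 - ρ ^ 2) ^ 2 = 1 - ρ ^ 2 := Real.sq_sqrt hρ.le
  have hπ : Real.sqrt (2 * Real.pi) ^ 2 = 2 * Real.pi := Real.sq_sqrt (by positivity)
  have inner : ∀ y₀ : ℝ, ∫ y₁ in Set.Iio b,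
      Real.exp (-(y₀ ^ 2 - 2 * ρ * y₀ * y₁ + y₁ ^ 2) / (2 * (1 - ρ ^ 2))) =
      Real.sqrt (1 - ρ ^ 2) * Real.sqrt (2 * Real.pi) *
        (Real.exp (-y₀ ^ 2 / 2) * normCDF ((b - ρ * y₀) / Real.sqrt (1 - ρ ^ 2))) := fun y₀ => by
    have hsub := setIntegral_Iio_comp_sub_div (fun u => Real.exp (-u ^ 2 / 2)) hs b (ρ * y₀)
    have hsplit : ∀ y₁ : ℝ,
        Real.exp (-(y₀ ^ 2 - 2 * ρ * y₀ * y₁ + y₁ ^ 2) / (2 * (1 - ρ ^ 2))) =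
        Real.exp (-y₀ ^ 2 / 2) *
          Real.exp (-((y₁ - ρ * y₀) / Real.sqrt (1 - ρ ^ 2)) ^ 2 / 2) := fun y₁ => by
      rw [← Real.exp_add, div_pow, hsq]
      congr 1
      field_simp
      ring
    simp_rw [hsplit]
    rw [integral_const_mul, hsub, normCDF]
    field_simp
  simp_rw [normCDF2, inner]
  rw [integral_const_mul, ← mul_assoc]
  congr 1
  field_simp
  exact hπ

/-- Logarithmic substitution `z = x * exp (m - k * s * y)`, with a sign `s`, on one of the two
sides of the level `ξ` in the positive half-line. -/
lemma setIntegral_pos_side_eq_setIntegral_Iio (g : ℝ → ℝ) {x ξ k s : ℝ} (m : ℝ) (hx : 0 < x)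
    (hξ : 0 < ξ) (hk : 0 < k) (hs : s = 1 ∨ s = -1) :
    ∫ z in {z : ℝ | 0 < z ∧ s * z > s * ξ}, g z =
      ∫ y in Set.Iio (s * ((Real.log (x / ξ) + m) / k)),
        k * (x * Real.exp (m - k * s * y)) * g (x * Real.exp (m - k * s * y)) := by
  set a := s * ((Real.log (x / ξ) + m) / k) with ha
  set f : ℝ → ℝ := fun y => x * Real.exp (m - k * s * y) with hf
  have hss : s * s = 1 := by rcases hs with rfl | rfl <;> norm_num
  have hs0 : s ≠ 0 := by rintro rfl; norm_num at hss
  have hpos : ∀ y, 0 < f y := fun y => by positivity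
  have hlog : ∀ y, Real.log (f y) = Real.log x + (m - k * s * y) := fun y => by
    rw [hf]
    simp only
    rw [Real.log_mul hx.ne' (Real.exp_ne_zero _), Real.log_exp]
  have hside : ∀ z, 0 < z → (s * ξ < s * z ↔ s * Real.log ξ < s * Real.log z) := fun z hz => by
    rcases hs with rfl | rfl
    · simp only [one_mul]
      exact (Real.log_lt_log_iff hξ hz).symm
    · simp only [neg_mul, one_mul, neg_lt_neg_iff]
      exact (Real.log_lt_log_iff hz hξ).symm
  have hlt : ∀ y, y < a ↔ s * Real.log ξ < s * Real.log (f y) := fun y => by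
    rw [ha, hlog, Real.log_div hx.ne' hξ.ne', ← mul_div_assoc, lt_div_iff₀ hk]
    have : s * (Real.log x + (m - k * s * y)) = s * (Real.log x + m) - k * y := by
      linear_combination -k * y * hss
    rw [this]
    constructor <;> intro h <;> linarith
  have himage : f '' Set.Iio a = {z : ℝ | 0 < z ∧ s * z > s * ξ} := by
    ext z
    simp only [Set.mem_image, Set.mem_Iio, Set.mem_ofPred_eq, gt_iff_lt]
    constructor
    · rintro ⟨y, hy, rfl⟩
      exact ⟨hpos y, (hside _ (hpos y)).2 ((hlt y).1 hy)⟩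
    · rintro ⟨hz, h⟩
      have hfz : f (s * ((Real.log (x / z) + m) / k)) = z := by
        apply Real.log_injOn_pos (hpos _) hz
        rw [hlog, Real.log_div hx.ne' hz.ne']
        field_simp
        linear_combination -(Real.log x - Real.log z + m) * hss
      refine ⟨_, ?_, hfz⟩
      rw [hlt, hfz]
      exact (hside z hz).1 h
  have hderiv : ∀ y ∈ Set.Iio a, HasDerivWithinAt f (f y * -(k * s)) (Set.Iio a) y :=
    fun y _ => by
      have h := ((((hasDerivAt_id y).const_mul (k * s)).const_sub m).exp.const_mul x)
      simpa [hf, mul_assoc] using h.hasDerivWithinAt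
  have hinj : Set.InjOn f (Set.Iio a) := fun u _ v _ h => by
    have := congrArg Real.log h
    rw [hlog, hlog] at this
    exact mul_left_cancel₀ (mul_ne_zero hk.ne' hs0) (by linarith)
  rw [← himage, integral_image_eq_integral_abs_deriv_smul measurableSet_Iio hderiv hinj]
  refine setIntegral_congr_fun measurableSet_Iio fun y _ => ?_
  have habs : |s| = 1 := by rcases hs with rfl | rfl <;> simp
  have : |f y * -(k * s)| = k * f y := by
    rw [abs_mul (f y), abs_neg, abs_mul k, habs, abs_of_pos (hpos y), abs_of_pos hk]
    ring
  simp only [this, smul_eq_mul]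
  rfl

/-- **Theorem 5 of Section 4.** The pricing formula of the second-order α-power binary
option: the Black–Scholes propagator from `t` to `T₀`, applied to the time-`T₀` price of the
first-order α-power binary option (with strike `ξ₁`, expiry `T₁`, sign `s₁`) restricted by
the indicator `1(s₀z > s₀ξ₀)`, equals `x^α e^{μ(α)(T₁−t)} N₂(s₀d₀, s₁d₁; s₀s₁ρ)`. -/
theorem second_order_power_binary_price (r q σ α ξ₀ ξ₁ s₀ s₁ t T₀ T₁ x : ℝ)
    (hσ : 0 < σ) (hξ₀ : 0 < ξ₀) (hξ₁ : 0 < ξ₁)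
    (hs₀ : s₀ = 1 ∨ s₀ = -1) (hs₁ : s₁ = 1 ∨ s₁ = -1)
    (ht : t < T₀) (hT : T₀ < T₁) (hx : 0 < x) :
    Real.exp (-(r * (T₀ - t))) / (σ * Real.sqrt (2 * Real.pi * (T₀ - t))) *
      ∫ z in {z : ℝ | 0 < z ∧ s₀ * z > s₀ * ξ₀},
        z⁻¹ *
          Real.exp (-(Real.log (x / z) + (r - q - σ ^ 2 / 2) * (T₀ - t)) ^ 2 /
            (2 * σ ^ 2 * (T₀ - t))) *
          (Real.exp (mu r q σ α * (T₁ - T₀)) * z ^ α *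
            normCDF (s₁ * ((Real.log (z / ξ₁) + (r - q - σ ^ 2 / 2 + α * σ ^ 2) * (T₁ - T₀)) /
              (σ * Real.sqrt (T₁ - T₀)))))
      = x ^ α * Real.exp (mu r q σ α * (T₁ - t)) *
          normCDF2
            (s₀ * ((Real.log (x / ξ₀) + (r - q - σ ^ 2 / 2 + α * σ ^ 2) * (T₀ - t)) /
              (σ * Real.sqrt (T₀ - t))))
            (s₁ * ((Real.log (x / ξ₁) + (r - q - σ ^ 2 / 2 + α * σ ^ 2) * (T₁ - t)) /
              (σ * Real.sqrt (T₁ - t))))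
            (s₀ * s₁ * Real.sqrt ((T₀ - t) / (T₁ - t))) := by
  have hτ₀ : 0 < T₀ - t := sub_pos.2 ht
  have hτ₁ : 0 < T₁ - T₀ := sub_pos.2 hT
  have hτ : 0 < T₁ - t := by linarith
  have hss₀ : s₀ ^ 2 = 1 := by rcases hs₀ with rfl | rfl <;> norm_num
  have hss₁ : s₁ ^ 2 = 1 := by rcases hs₁ with rfl | rfl <;> norm_num
  have hk₀ : 0 < Real.sqrt (T₀ - t) := Real.sqrt_pos.2 hτ₀
  have hk₁ : 0 < Real.sqrt (T₁ - T₀) := Real.sqrt_pos.2 hτ₁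
  have hk : 0 < Real.sqrt (T₁ - t) := Real.sqrt_pos.2 hτ
  have hsq₀ : Real.sqrt (T₀ - t) ^ 2 = T₀ - t := Real.sq_sqrt hτ₀.le
  have hρ : 1 - (s₀ * s₁ * Real.sqrt ((T₀ - t) / (T₁ - t))) ^ 2 = (T₁ - T₀) / (T₁ - t) := by
    rw [mul_pow, mul_pow, hss₀, hss₁, Real.sq_sqrt (by positivity)]
    field_simp
    ring
  rw [normCDF2_eq_integral_normCDF _ _ (by rw [hρ]; positivity), hρ,
    setIntegral_pos_side_eq_setIntegral_Iio _ ((r - q - σ ^ 2 / 2 + α * σ ^ 2) * (T₀ - t)) hx hξ₀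
      (mul_pos hσ hk₀) hs₀,
    ← integral_const_mul, ← integral_const_mul, ← integral_const_mul]
  refine setIntegral_congr_fun measurableSet_Iio fun y _ => ?_
  set m := (r - q - σ ^ 2 / 2 + α * σ ^ 2) * (T₀ - t) with hm
  set w := m - σ * Real.sqrt (T₀ - t) * s₀ * y with hw
  have hz : 0 < x * Real.exp w := by positivity
  have hlogz : Real.log (x * Real.exp w) = Real.log x + w := by
    rw [Real.log_mul hx.ne' (Real.exp_ne_zero _), Real.log_exp]
  have hN : s₁ * ((Real.log (x * Real.exp w / ξ₁) +
        (r - q - σ ^ 2 / 2 + α * σ ^ 2) * (T₁ - T₀)) / (σ * Real.sqrt (T₁ - T₀))) =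
      (s₁ * ((Real.log (x / ξ₁) + (r - q - σ ^ 2 / 2 + α * σ ^ 2) * (T₁ - t)) /
        (σ * Real.sqrt (T₁ - t))) - s₀ * s₁ * Real.sqrt ((T₀ - t) / (T₁ - t)) * y) /
        Real.sqrt ((T₁ - T₀) / (T₁ - t)) := by
    rw [Real.log_div hz.ne' hξ₁.ne', hlogz, Real.log_div hx.ne' hξ₁.ne',
      Real.sqrt_div hτ₀.le, Real.sqrt_div hτ₁.le, hw, hm]
    field_simp
    ring
  have hpow : (x * Real.exp w) ^ α = x ^ α * Real.exp (w * α) := by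
    rw [Real.mul_rpow hx.le (Real.exp_pos _).le, ← Real.exp_mul]
  have hquad : Real.log (x / (x * Real.exp w)) + (r - q - σ ^ 2 / 2) * (T₀ - t) =
      σ * Real.sqrt (T₀ - t) * (s₀ * y - α * σ * Real.sqrt (T₀ - t)) := by
    rw [Real.log_div hx.ne' hz.ne', hlogz, hw, hm]
    linear_combination α * σ ^ 2 * hsq₀
  have hexp : Real.exp (-(r * (T₀ - t))) *
        Real.exp (-(σ * Real.sqrt (T₀ - t) * (s₀ * y - α * σ * Real.sqrt (T₀ - t))) ^ 2 /
          (2 * σ ^ 2 * (T₀ - t))) * Real.exp (mu r q σ α * (T₁ - T₀)) * Real.exp (w * α) =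
      Real.exp (mu r q σ α * (T₁ - t)) * Real.exp (-y ^ 2 / 2) := by
    have hsimp : -(σ * Real.sqrt (T₀ - t) * (s₀ * y - α * σ * Real.sqrt (T₀ - t))) ^ 2 /
        (2 * σ ^ 2 * (T₀ - t)) = -(s₀ * y - α * σ * Real.sqrt (T₀ - t)) ^ 2 / 2 := by
      rw [mul_pow, mul_pow, hsq₀]
      field_simp
    rw [hsimp, ← Real.exp_add, ← Real.exp_add, ← Real.exp_add, ← Real.exp_add, hw, hm, mu]
    congr 1
    linear_combination -(y ^ 2 / 2) * hss₀ - (α ^ 2 * σ ^ 2 / 2) * hsq₀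
  rw [hN, hpow, hquad, Real.sqrt_mul (by positivity) (T₀ - t)]
  generalize normCDF _ = N
  generalize Real.sqrt (2 * Real.pi) = p at *
  rw [show x ^ α * Real.exp (mu r q σ α * (T₁ - t)) * (p⁻¹ * (Real.exp (-y ^ 2 / 2) * N)) =
    x ^ α * p⁻¹ * N * (Real.exp (mu r q σ α * (T₁ - t)) * Real.exp (-y ^ 2 / 2)) by ring, ← hexp]
  generalize x * Real.exp w = z at *
  generalize Real.exp _ = A
  generalize Real.exp _ = B
  generalize Real.exp _ = C
  generalize Real.exp _ = D
  field_simp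
end
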